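/- For any hypergraphs H₁ and H₂ (with nonempty edge sets), the cover number of the wreath product satisfies τ(H₁ ⋊ H₂) = τ(H₁) · τ(H₂). -/

import Mathlib

open Finset

/-- The cover number of a hypergraph given by a set of edges: the minimum size of a
set of vertices meeting every edge. -/
noncomputable def coverNumberSet {V : Type*} [DecidableEq V] (H : Set (Finset V)) : ℕ :=
  sInf {k | ∃ T : Finset V, T.card = k ∧ ∀ e ∈ H, (e ∩ T).Nonempty}

/-- The cover number of a hypergraph: the minimum size of a set of vertices
meeting every edge. -/
noncomputable def coverNumber {V : Type*} [DecidableEq V] (H : Finset (Finset V)) : ℕ :=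
  coverNumberSet (H : Set (Finset V))

/-- The wreath product of two hypergraphs: its vertex set is `V₁ × V₂` and its edges
are exactly the sets `{(v,u) : v ∈ e, u ∈ f v}` arising from an edge `e ∈ H₁` together
with a choice of an edge `f v ∈ H₂` for each `v ∈ e`. -/
def wreath {V₁ V₂ : Type*} [DecidableEq V₁] [DecidableEq V₂]
    (H₁ : Finset (Finset V₁)) (H₂ : Finset (Finset V₂)) : Set (Finset (V₁ × V₂)) :=
  {X | ∃ e ∈ H₁, ∃ f : V₁ → Finset V₂, (∀ v ∈ e, f v ∈ H₂) ∧
    X = e.biUnion fun v => (f v).image fun u => (v, u)}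

theorem cns_le {V : Type*} [DecidableEq V] (H : Set (Finset V)) (T : Finset V)
    (h : ∀ e ∈ H, (e ∩ T).Nonempty) : coverNumberSet H ≤ T.card :=
  Nat.sInf_le ⟨T, rfl, h⟩

theorem cns_attained {V : Type*} [DecidableEq V] (H : Set (Finset V)) (T : Finset V)
    (h : ∀ e ∈ H, (e ∩ T).Nonempty) :
    ∃ S : Finset V, S.card = coverNumberSet H ∧ ∀ e ∈ H, (e ∩ S).Nonempty :=
  Nat.sInf_mem (s := {k | ∃ T : Finset V, T.card = k ∧ ∀ e ∈ H, (e ∩ T).Nonempty}) ⟨_, T, rfl, h⟩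

theorem cns_empty {V : Type*} [DecidableEq V] (H : Set (Finset V)) (h : ∅ ∈ H) :
    coverNumberSet H = 0 := by
  unfold coverNumberSet
  rw [Nat.sInf_eq_zero]
  right
  ext k
  simp only [Set.mem_setOf_eq, Set.mem_empty_iff_false, iff_false]
  rintro ⟨T, -, hT⟩
  simpa using hT ∅ h

theorem cover_exists {V : Type*} [DecidableEq V] (H : Finset (Finset V)) (h : ∅ ∉ H) :
    ∀ e ∈ (H : Set (Finset V)), (e ∩ H.biUnion id).Nonempty := by
  intro e he
  have he' : e ∈ H := he
  obtain ⟨x, hx⟩ : e.Nonempty := by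
    rw [Finset.nonempty_iff_ne_empty]
    rintro rfl
    exact h he'
  exact ⟨x, Finset.mem_inter.2 ⟨hx, Finset.mem_biUnion.2 ⟨e, he', hx⟩⟩⟩

theorem stmt_7 {V₁ V₂ : Type*} [DecidableEq V₁] [DecidableEq V₂]
    (H₁ : Finset (Finset V₁)) (H₂ : Finset (Finset V₂))
    (h₁ : H₁.Nonempty) (h₂ : H₂.Nonempty) :
    coverNumberSet (wreath H₁ H₂) = coverNumber H₁ * coverNumber H₂ := by
  classical
  unfold coverNumber
  by_cases e₁ : ∅ ∈ H₁
  · rw [cns_empty (H₁ : Set (Finset V₁)) e₁, zero_mul]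
    apply cns_empty
    exact ⟨∅, e₁, fun _ => ∅, by simp, by simp⟩
  by_cases e₂ : ∅ ∈ H₂
  · rw [cns_empty (H₂ : Set (Finset V₂)) e₂, mul_zero]
    apply cns_empty
    obtain ⟨e, he⟩ := h₁
    refine ⟨e, he, fun _ => ∅, fun _ _ => e₂, ?_⟩
    ext x
    simp
  obtain ⟨T₁, c₁, hT₁⟩ := cns_attained _ _ (cover_exists H₁ e₁)
  obtain ⟨T₂, c₂, hT₂⟩ := cns_attained _ _ (cover_exists H₂ e₂)
  have hprod : ∀ X ∈ wreath H₁ H₂, (X ∩ T₁ ×ˢ T₂).Nonempty := by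
    rintro X ⟨e, he, f, hf, rfl⟩
    obtain ⟨v, hv⟩ := hT₁ e he
    rw [Finset.mem_inter] at hv
    obtain ⟨u, hu⟩ := hT₂ (f v) (hf v hv.1)
    rw [Finset.mem_inter] at hu
    refine ⟨(v, u), Finset.mem_inter.2 ⟨?_, Finset.mem_product.2 ⟨hv.2, hu.2⟩⟩⟩
    exact Finset.mem_biUnion.2 ⟨v, hv.1, Finset.mem_image.2 ⟨u, hu.1, rfl⟩⟩
  apply le_antisymm
  · rw [← c₁, ← c₂, ← Finset.card_product]
    exact cns_le _ _ hprod
  obtain ⟨T, c, hT⟩ := cns_attained _ _ hprod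
  rw [← c]
  let F : V₁ → Finset (V₁ × V₂) := fun v => T.filter (fun p => p.1 = v)
  let S : Finset V₁ := (T.image Prod.fst).filter
    (fun v => ∀ g ∈ H₂, (g ∩ (F v).image Prod.snd).Nonempty)
  have hS : ∀ e ∈ (H₁ : Set (Finset V₁)), (e ∩ S).Nonempty := by
    intro e he
    by_contra hcon
    have key : ∀ v, ∃ g, v ∈ e → g ∈ H₂ ∧ ¬ (g ∩ (F v).image Prod.snd).Nonempty := by
      intro v
      by_cases hv : v ∈ e
      · by_contra hno
        push Not at hno
        have hall : ∀ g ∈ H₂, (g ∩ (F v).image Prod.snd).Nonempty := by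
          intro g hg
          by_contra hh
          exact hh ((hno g).2 hg)
        apply hcon
        refine ⟨v, Finset.mem_inter.2 ⟨hv, Finset.mem_filter.2 ⟨?_, hall⟩⟩⟩
        obtain ⟨g, hg⟩ := h₂
        obtain ⟨u, hu⟩ := hall g hg
        obtain ⟨p, hp, -⟩ := Finset.mem_image.1 (Finset.mem_inter.1 hu).2
        have hp' := Finset.mem_filter.1 hp
        exact Finset.mem_image.2 ⟨p, hp'.1, hp'.2⟩
      · exact ⟨∅, fun h => absurd h hv⟩
    choose f hf using key
    obtain ⟨p, hp⟩ := hT _ ⟨e, he, f, fun v hv => (hf v hv).1, rfl⟩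
    obtain ⟨hp1, hp2⟩ := Finset.mem_inter.1 hp
    obtain ⟨v, hv, hp3⟩ := Finset.mem_biUnion.1 hp1
    obtain ⟨u, hu, rfl⟩ := Finset.mem_image.1 hp3
    refine (hf v hv).2 ⟨u, Finset.mem_inter.2 ⟨hu, Finset.mem_image.2 ⟨(v, u), ?_, rfl⟩⟩⟩
    exact Finset.mem_filter.2 ⟨hp2, rfl⟩
  calc _ ≤ S.card * coverNumberSet (H₂ : Set (Finset V₂)) :=
        Nat.mul_le_mul_right _ (cns_le _ _ hS)
    _ = ∑ _v ∈ S, coverNumberSet (H₂ : Set (Finset V₂)) := by simp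
    _ ≤ ∑ v ∈ S, (F v).card := by
        apply Finset.sum_le_sum
        intro v hv
        exact (cns_le _ _ (Finset.mem_filter.1 hv).2).trans Finset.card_image_le
    _ ≤ ∑ v ∈ T.image Prod.fst, (F v).card :=
        Finset.sum_le_sum_of_subset (Finset.filter_subset _ _)
    _ = T.card := (Finset.card_eq_sum_card_image Prod.fst T).symm
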